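/- Let k = (k₁,…,k_n):ℝⁿ∖{0}→ℝⁿ be of class C² on ℝⁿ∖{0} and homogeneous of degree 1−n. For i,j ∈ {1,…,n} set c_{ij} = ∫_{∂B(0,1)} k_j(s) s_i dσ(s). Then for every f ∈ C_c^∞(ℝⁿ;ℝ) and every x ∈ ℝⁿ, the derivative of the convolution satisfies ∂_i (k_j ∗ f)(x) = lim_{ε→0} ∫_{|x−y|>ε} ∂_i k_j(x−y) f(y) dy + c_{ij} f(x); equivalently, the distributional derivative of k_j is ∂_i k_j = p.v. ∂_i k_j + c_{ij} δ₀. -/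

import Mathlib

open MeasureTheory ENNReal Metric Set

noncomputable section

abbrev Euc (n : ℕ) := EuclideanSpace ℝ (Fin n)

/-- partial derivative in the `i`-th coordinate direction -/
def pd {n : ℕ} (i : Fin n) (f : Euc n → ℝ) (x : Euc n) : ℝ :=
  fderiv ℝ f x (EuclideanSpace.single i 1)

/-- a vector field on `ℝⁿ` is (positively) homogeneous of degree `1 - n`. -/
def Homog1nV {n : ℕ} (k : Euc n → Euc n) : Prop :=
  ∀ c : ℝ, 0 < c → ∀ x : Euc n, x ≠ 0 → k (c • x) = c ^ ((1 : ℝ) - n) • k x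

section Polar

variable {E : Type*} [NormedAddCommGroup E] [NormedSpace ℝ E]

theorem eq_inv_norm_pow_mul_of_homogeneous {g : E → ℝ}
    (hom : ∀ c : ℝ, 0 < c → ∀ t : E, t ≠ 0 →
      g (c • t) = (c ^ (Module.finrank ℝ E - 1))⁻¹ * g t) {t : E} (ht : t ≠ 0) :
    g t = (‖t‖ ^ (Module.finrank ℝ E - 1))⁻¹ * g (‖t‖⁻¹ • t) := by
  have h : 0 < ‖t‖ := norm_pos_iff.2 ht
  rw [← hom _ h _ (smul_ne_zero (inv_ne_zero h.ne') ht), smul_inv_smul₀ h.ne']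

variable [FiniteDimensional ℝ E]

theorem exists_abs_le_inv_norm_pow_of_homogeneous {g : E → ℝ} (hg : ContinuousOn g {0}ᶜ)
    (hom : ∀ c : ℝ, 0 < c → ∀ t : E, t ≠ 0 →
      g (c • t) = (c ^ (Module.finrank ℝ E - 1))⁻¹ * g t) :
    ∃ M : ℝ, 0 ≤ M ∧ ∀ t : E, t ≠ 0 →
      |g t| ≤ M * (‖t‖ ^ (Module.finrank ℝ E - 1))⁻¹ := by
  obtain ⟨M, hM⟩ := (isCompact_sphere (0 : E) 1).exists_bound_of_continuousOn
    (hg.mono fun t ht h => by simp_all)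
  refine ⟨max M 0, le_max_right _ _, fun t ht => ?_⟩
  have h : 0 < ‖t‖ := norm_pos_iff.2 ht
  rw [eq_inv_norm_pow_mul_of_homogeneous hom ht, abs_mul, abs_of_nonneg (by positivity), mul_comm]
  gcongr
  refine le_trans (hM _ ?_) (le_max_left _ _)
  simp [norm_smul, h.ne']

variable [MeasurableSpace E] [BorelSpace E] [Nontrivial E] (μ : Measure E) [μ.IsAddHaarMeasure]

/-- Polar coordinates for the product of a radial function and a function which is
homogeneous of degree `1 - dim E`. -/
theorem integral_radial_mul_homogeneous (φ : ℝ → ℝ) (q : E → ℝ) :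
    ∫ t, φ ‖t‖ * ((‖t‖ ^ (Module.finrank ℝ E - 1))⁻¹ * q (‖t‖⁻¹ • t)) ∂μ =
      (∫ r in Ioi (0 : ℝ), φ r) * ∫ s : sphere (0 : E) 1, q s ∂μ.toSphere := by
  have key := μ.measurePreserving_homeomorphUnitSphereProd.integral_comp
    (Homeomorph.measurableEmbedding _)
    (fun p : sphere (0 : E) 1 × Ioi (0 : ℝ) =>
      q p.1 * (φ p.2 * ((p.2 : ℝ) ^ (Module.finrank ℝ E - 1))⁻¹))
  calc ∫ t, φ ‖t‖ * ((‖t‖ ^ (Module.finrank ℝ E - 1))⁻¹ * q (‖t‖⁻¹ • t)) ∂μ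
      = ∫ t : ({(0 : E)}ᶜ : Set E), φ ‖(t : E)‖ *
          ((‖(t : E)‖ ^ (Module.finrank ℝ E - 1))⁻¹ * q (‖(t : E)‖⁻¹ • (t : E))) ∂μ.comap (↑) := by
        rw [integral_subtype_comap (measurableSet_singleton _).compl
          fun t ↦ φ ‖t‖ * ((‖t‖ ^ (Module.finrank ℝ E - 1))⁻¹ * q (‖t‖⁻¹ • t)),
          restrict_compl_singleton]
    _ = ∫ p, q p.1 * (φ p.2 * ((p.2 : ℝ) ^ (Module.finrank ℝ E - 1))⁻¹)
          ∂μ.toSphere.prod (.volumeIoiPow (Module.finrank ℝ E - 1)) := by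
        rw [← key]
        refine integral_congr_ae (.of_forall fun t => ?_)
        simp only [homeomorphUnitSphereProd_apply_fst_coe, homeomorphUnitSphereProd_apply_snd_coe]
        ring
    _ = (∫ s : sphere (0 : E) 1, q s ∂μ.toSphere) *
          ∫ r : Ioi (0 : ℝ), φ r * ((r : ℝ) ^ (Module.finrank ℝ E - 1))⁻¹
            ∂.volumeIoiPow (Module.finrank ℝ E - 1) :=
        integral_prod_mul (fun s : sphere (0 : E) 1 => q s)
          (fun r : Ioi (0 : ℝ) => φ r * ((r : ℝ) ^ (Module.finrank ℝ E - 1))⁻¹)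
    _ = _ := by
        rw [mul_comm]
        congr 1
        simp only [Measure.volumeIoiPow, ENNReal.ofReal]
        rw [integral_withDensity_eq_integral_smul, integral_subtype_comap measurableSet_Ioi
          fun a ↦ Real.toNNReal (a ^ (Module.finrank ℝ E - 1)) •
            (φ a * (a ^ (Module.finrank ℝ E - 1))⁻¹),
          setIntegral_congr_fun measurableSet_Ioi fun x hx ↦ ?_]
        · have hx' : (x : ℝ) ^ (Module.finrank ℝ E - 1) ≠ 0 := pow_ne_zero _ (ne_of_gt hx)
          rw [NNReal.smul_def, Real.coe_toNNReal _ (pow_nonneg hx.out.le _), smul_eq_mul]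
          field_simp
        · exact (measurable_subtype_coe.pow_const _).real_toNNReal

theorem locallyIntegrable_inv_norm_pow_finrank_sub_one :
    LocallyIntegrable (fun t : E => (‖t‖ ^ (Module.finrank ℝ E - 1))⁻¹) μ := by
  rw [locallyIntegrable_iff]
  intro K hK
  obtain ⟨R, hR⟩ := hK.isBounded.subset_ball 0
  refine IntegrableOn.mono_set ?_ hR
  refine (integrableOn_fun_norm_addHaar μ (f := fun r => (r ^ (Module.finrank ℝ E - 1))⁻¹)).2 ?_
  refine (integrableOn_congr_fun (g := fun _ => (1 : ℝ)) ?_ measurableSet_Ioo).2 (by simp)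
  intro r hr
  have : r ^ (Module.finrank ℝ E - 1) ≠ 0 := pow_ne_zero _ hr.1.ne'
  simp [this]

theorem aestronglyMeasurable_of_continuousOn_compl_zero {g : E → ℝ}
    (hg : ContinuousOn g {0}ᶜ) : AEStronglyMeasurable g μ := by
  rw [← restrict_compl_singleton (μ := μ) 0]
  exact hg.aestronglyMeasurable (measurableSet_singleton _).compl

theorem locallyIntegrable_of_homogeneous {g : E → ℝ} (hg : ContinuousOn g {0}ᶜ)
    (hom : ∀ c : ℝ, 0 < c → ∀ t : E, t ≠ 0 →
      g (c • t) = (c ^ (Module.finrank ℝ E - 1))⁻¹ * g t) : LocallyIntegrable g μ := by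
  obtain ⟨M, hM0, hM⟩ := exists_abs_le_inv_norm_pow_of_homogeneous hg hom
  refine ((locallyIntegrable_inv_norm_pow_finrank_sub_one μ).smul M).mono
    (aestronglyMeasurable_of_continuousOn_compl_zero μ hg) ?_
  filter_upwards [compl_mem_ae_iff.2 (measure_singleton (μ := μ) (0 : E))] with t ht
  rw [Real.norm_eq_abs]
  exact (hM t ht).trans (le_abs_self _)

end Polar

section RadialCutoff

variable {E : Type*} [NormedAddCommGroup E]

theorem continuous_radial_mul {φ : ℝ → ℝ} {w : E → ℝ} {ε : ℝ} (hφ : Continuous φ) (hε : 0 < ε)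
    (hφ0 : ∀ r < ε, φ r = 0) (hw : ContinuousOn w {0}ᶜ) : Continuous fun t => φ ‖t‖ * w t := by
  rw [continuous_iff_continuousAt]
  intro t
  by_cases ht : t = 0
  · subst ht
    refine (continuousAt_const (y := (0 : ℝ))).congr ?_
    filter_upwards [ball_mem_nhds (0 : E) hε] with s hs
    rw [hφ0 _ (by simpa using hs), zero_mul]
  · exact (hφ.comp continuous_norm).continuousAt.mul
      (hw.continuousAt (isOpen_compl_singleton.mem_nhds ht))

variable [InnerProductSpace ℝ E]

theorem contDiff_radial_mul {ψ : ℝ → ℝ} {g : E → ℝ} {ε : ℝ} (hψ : ContDiff ℝ 1 ψ) (hε : 0 < ε)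
    (hψ0 : ∀ r ≤ ε, ψ r = 0) (hg : ContDiffOn ℝ 1 g {0}ᶜ) :
    ContDiff ℝ 1 fun t => ψ ‖t‖ * g t := by
  rw [contDiff_iff_contDiffAt]
  intro t
  by_cases ht : t = 0
  · subst ht
    refine (contDiffAt_const (c := (0 : ℝ))).congr_of_eventuallyEq ?_
    filter_upwards [ball_mem_nhds (0 : E) hε] with s hs
    rw [hψ0 _ (by simpa using le_of_lt (mem_ball_zero_iff.1 hs)), zero_mul]
  · exact (hψ.contDiffAt.comp t (contDiffAt_norm ℝ ht)).mul
      (hg.contDiffAt (isOpen_compl_singleton.mem_nhds ht))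

theorem fderiv_radial_mul_apply {ψ : ℝ → ℝ} {g : E → ℝ} (hψ : Differentiable ℝ ψ) {t : E}
    (ht : t ≠ 0) (hg : DifferentiableAt ℝ g t) (v : E) :
    fderiv ℝ (fun t => ψ ‖t‖ * g t) t v =
      ψ ‖t‖ * fderiv ℝ g t v + deriv ψ ‖t‖ * (inner ℝ t v / ‖t‖ * g t) := by
  have h1 : HasFDerivAt (fun t : E => ‖t‖) (fderiv ℝ (fun t : E => ‖t‖) t) t :=
    ((contDiffAt_norm ℝ (n := 1) ht).differentiableAt one_ne_zero).hasFDerivAt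
  have h2 := ((hψ ‖t‖).hasDerivAt.comp_hasFDerivAt t h1).mul hg.hasFDerivAt
  have h3 : fderiv ℝ (fun t : E => ‖t‖) t v = inner ℝ t v / ‖t‖ := by
    have hsq : HasFDerivAt (fun t : E => ‖t‖ * ‖t‖) (2 • innerSL ℝ t) t := by
      simpa only [pow_two] using (hasStrictFDerivAt_norm_sq t).hasFDerivAt
    have h4 := congrArg (fun L : E →L[ℝ] ℝ => L v) ((h1.mul h1).unique hsq)
    have h5 : ‖t‖ ≠ 0 := norm_ne_zero_iff.2 ht
    simp only [add_apply, smul_apply, innerSL_apply_apply,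
      smul_eq_mul, nsmul_eq_mul, Nat.cast_ofNat] at h4
    rw [eq_div_iff h5]
    linarith
  change fderiv ℝ ((ψ ∘ fun t => ‖t‖) * g) t v = _
  rw [h2.fderiv]
  simp [h3]
  ring

theorem continuousOn_fderiv_apply_compl_zero {g : E → ℝ} (hg : ContDiffOn ℝ 1 g {0}ᶜ) (v : E) :
    ContinuousOn (fun t => fderiv ℝ g t v) {0}ᶜ :=
  (hg.continuousOn_fderiv_of_isOpen isOpen_compl_singleton le_rfl).clm_apply continuousOn_const

theorem continuousOn_inner_div_norm_mul {g : E → ℝ} (hg : ContinuousOn g {0}ᶜ) (v : E) :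
    ContinuousOn (fun t => inner ℝ t v / ‖t‖ * g t) {0}ᶜ :=
  ((by fun_prop : Continuous fun t : E => inner ℝ t v).continuousOn.div
    continuous_norm.continuousOn fun _ ht => norm_ne_zero_iff.2 ht).mul hg

theorem deriv_eq_zero_of_forall_le {ψ : ℝ → ℝ} {ε : ℝ} (hψ0 : ∀ r ≤ ε, ψ r = 0) :
    ∀ r < ε, deriv ψ r = 0 := fun r hr => by
  have : ψ =ᶠ[nhds r] fun _ => 0 := by
    filter_upwards [Iio_mem_nhds hr] with s hs using hψ0 s (le_of_lt hs)
  rw [this.deriv_eq, deriv_const]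

theorem integral_deriv_cutoff {ψ : ℝ → ℝ} {a b : ℝ} (hψ : ContDiff ℝ 1 ψ) (hmono : Monotone ψ)
    (ha : 0 < a) (hψ0 : ∀ r ≤ a, ψ r = 0) (hψ1 : ∀ r, b ≤ r → ψ r = 1) :
    ∫ r in Ioi (0 : ℝ), deriv ψ r = 1 := by
  rw [integral_Ioi_of_hasDerivAt_of_nonneg'
    (fun r _ => (hψ.differentiable one_ne_zero r).hasDerivAt) (fun r _ => hmono.deriv_nonneg)
    (l := 1), hψ0 0 ha.le, sub_zero]
  refine tendsto_const_nhds.congr' ?_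
  filter_upwards [Filter.eventually_ge_atTop b] with r hr using (hψ1 r hr).symm

end RadialCutoff

section IntegrationByParts

variable {E : Type*} [NormedAddCommGroup E] [InnerProductSpace ℝ E] [FiniteDimensional ℝ E]
  [MeasurableSpace E] [BorelSpace E] [Nontrivial E]

theorem integral_radial_cutoff {μ : Measure E} [μ.IsAddHaarMeasure]
    {ψ : ℝ → ℝ} {g h : E → ℝ} {ε : ℝ} (hψ : ContDiff ℝ 1 ψ)
    (hε : 0 < ε) (hψ0 : ∀ r ≤ ε, ψ r = 0) (hg : ContDiffOn ℝ 1 g {0}ᶜ) (hh : ContDiff ℝ 1 h)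
    (hhc : HasCompactSupport h) (v : E) :
    ∫ t, ψ ‖t‖ * (g t * fderiv ℝ h t v + fderiv ℝ g t v * h t) ∂μ =
      -∫ t, deriv ψ ‖t‖ * (inner ℝ t v / ‖t‖ * g t) * h t ∂μ := by
  have hG := contDiff_radial_mul hψ hε hψ0 hg
  have hh' : Continuous fun t => fderiv ℝ h t v :=
    (hh.continuous_fderiv one_ne_zero).clm_apply continuous_const
  have hhc' : HasCompactSupport fun t => fderiv ℝ h t v := hhc.fderiv_apply ℝ v
  have hG' : Continuous fun t => fderiv ℝ (fun t => ψ ‖t‖ * g t) t v :=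
    (hG.continuous_fderiv one_ne_zero).clm_apply continuous_const
  have c1 := continuous_radial_mul hψ.continuous hε (fun r hr => hψ0 r hr.le)
    (continuousOn_fderiv_apply_compl_zero hg v)
  have c2 := continuous_radial_mul (hψ.continuous_deriv le_rfl) hε
    (deriv_eq_zero_of_forall_le hψ0) (continuousOn_inner_div_norm_mul hg.continuousOn v)
  have i0 : Integrable (fun t => (ψ ‖t‖ * g t) * fderiv ℝ h t v) μ :=
    (hG.continuous.mul hh').integrable_of_hasCompactSupport hhc'.mul_left
  have i1 : Integrable (fun t => (ψ ‖t‖ * fderiv ℝ g t v) * h t) μ :=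
    (c1.mul hh.continuous).integrable_of_hasCompactSupport hhc.mul_left
  have i2 : Integrable (fun t => deriv ψ ‖t‖ * (inner ℝ t v / ‖t‖ * g t) * h t) μ :=
    (c2.mul hh.continuous).integrable_of_hasCompactSupport hhc.mul_left
  have ibp := integral_mul_fderiv_eq_neg_fderiv_mul_of_integrable (μ := μ) (v := v)
    (f := fun t => ψ ‖t‖ * g t) (g := h)
    ((hG'.mul hh.continuous).integrable_of_hasCompactSupport hhc.mul_left) i0
    ((hG.continuous.mul hh.continuous).integrable_of_hasCompactSupport hhc.mul_left)
    (fun t _ => hG.differentiable one_ne_zero t) (fun t _ => hh.differentiable one_ne_zero t)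
  have e : ∫ t, fderiv ℝ (fun t => ψ ‖t‖ * g t) t v * h t ∂μ =
      ∫ t, (ψ ‖t‖ * fderiv ℝ g t v) * h t ∂μ +
        ∫ t, deriv ψ ‖t‖ * (inner ℝ t v / ‖t‖ * g t) * h t ∂μ := by
    rw [← integral_add i1 i2]
    refine integral_congr_ae ?_
    filter_upwards [compl_mem_ae_iff.2 (measure_singleton (μ := μ) (0 : E))] with t ht
    rw [fderiv_radial_mul_apply (hψ.differentiable one_ne_zero) ht
      ((hg.contDiffAt (isOpen_compl_singleton.mem_nhds ht)).differentiableAt one_ne_zero)]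
    ring
  have e' : ∫ t, ψ ‖t‖ * (g t * fderiv ℝ h t v + fderiv ℝ g t v * h t) ∂μ =
      ∫ t, (ψ ‖t‖ * g t) * fderiv ℝ h t v ∂μ + ∫ t, (ψ ‖t‖ * fderiv ℝ g t v) * h t ∂μ := by
    rw [← integral_add i0 i1]
    congr with t
    ring
  rw [e', ibp, e]
  ring

theorem abs_integral_radial_cutoff_add_le (μ : Measure E) [μ.IsAddHaarMeasure] {g h : E → ℝ}
    (hg : ContDiffOn ℝ 1 g {0}ᶜ)
    (hom : ∀ c : ℝ, 0 < c → ∀ t : E, t ≠ 0 →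
      g (c • t) = (c ^ (Module.finrank ℝ E - 1))⁻¹ * g t)
    (hh : ContDiff ℝ 1 h) (hhc : HasCompactSupport h) (v : E) :
    ∃ C : ℝ, ∀ (ψ : ℝ → ℝ) (a b : ℝ), ContDiff ℝ 1 ψ → Monotone ψ → 0 < a → a ≤ b →
      (∀ r ≤ a, ψ r = 0) → (∀ r, b ≤ r → ψ r = 1) →
      |∫ t, ψ ‖t‖ * (g t * fderiv ℝ h t v + fderiv ℝ g t v * h t) ∂μ +
        (∫ s : sphere (0 : E) 1, g s * inner ℝ (s : E) v ∂μ.toSphere) * h 0| ≤ C * b := by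
  obtain ⟨M, hM0, hM⟩ := exists_abs_le_inv_norm_pow_of_homogeneous hg.continuousOn hom
  obtain ⟨L, hL⟩ := hh.lipschitzWith_of_hasCompactSupport hhc one_ne_zero
  refine ⟨M * ‖v‖ * L * μ.toSphere.real univ, fun ψ a b hψ hmono ha hab hψ0 hψ1 => ?_⟩
  have hb : 0 < b := ha.trans_le hab
  have hd0 := deriv_eq_zero_of_forall_le hψ0
  have hd1 : ∀ r, b < r → deriv ψ r = 0 := fun r hr => by
    have : ψ =ᶠ[nhds r] fun _ => 1 := by
      filter_upwards [Ioi_mem_nhds hr] with s hs using hψ1 s (le_of_lt hs)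
    rw [this.deriv_eq, deriv_const]
  have hdc : HasCompactSupport fun t : E => deriv ψ ‖t‖ := by
    refine HasCompactSupport.intro (isCompact_closedBall (0 : E) b) fun t ht => hd1 _ ?_
    simpa using ht
  have hψ' := hψ.continuous_deriv le_rfl
  have hne : ∀ᵐ t ∂μ, t ≠ 0 := compl_mem_ae_iff.2 (measure_singleton (μ := μ) (0 : E))
  have hint := integral_deriv_cutoff hψ hmono ha hψ0 hψ1
  have c2 := continuous_radial_mul hψ' ha hd0 (continuousOn_inner_div_norm_mul hg.continuousOn v)
  have i0 : Integrable (fun t => deriv ψ ‖t‖ * (inner ℝ t v / ‖t‖ * g t) * h 0) μ :=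
    (c2.mul continuous_const).integrable_of_hasCompactSupport hdc.mul_right.mul_right
  have i1 : Integrable (fun t => deriv ψ ‖t‖ * (inner ℝ t v / ‖t‖ * g t) * h t) μ :=
    (c2.mul hh.continuous).integrable_of_hasCompactSupport hhc.mul_left
  have hmain : ∫ t, deriv ψ ‖t‖ * (inner ℝ t v / ‖t‖ * g t) * h 0 ∂μ =
      (∫ s : sphere (0 : E) 1, g s * inner ℝ (s : E) v ∂μ.toSphere) * h 0 := by
    rw [integral_mul_const]
    congr 1
    have := integral_radial_mul_homogeneous μ (deriv ψ) fun s : E => g s * inner ℝ s v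
    rw [hint, one_mul] at this
    rw [← this]
    refine integral_congr_ae ?_
    filter_upwards [hne] with t ht
    rw [eq_inv_norm_pow_mul_of_homogeneous hom ht, real_inner_smul_left]
    ring
  have hbound : Integrable (fun t : E => deriv ψ ‖t‖ *
      ((‖t‖ ^ (Module.finrank ℝ E - 1))⁻¹ * (M * ‖v‖ * L * b))) μ := by
    refine (continuous_radial_mul hψ' ha hd0 ?_).integrable_of_hasCompactSupport hdc.mul_right
    exact ((continuous_norm.pow _).continuousOn.inv₀
      fun t ht => pow_ne_zero _ (norm_ne_zero_iff.2 ht)).mul continuousOn_const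
  rw [integral_radial_cutoff hψ ha hψ0 hg hh hhc v, ← hmain, neg_add_eq_sub, ← integral_sub i0 i1,
    ← Real.norm_eq_abs]
  refine (norm_integral_le_of_norm_le hbound ?_).trans_eq ?_
  · filter_upwards [hne] with t ht
    have hpos : 0 < ‖t‖ := norm_pos_iff.2 ht
    by_cases htb : b < ‖t‖
    · simp [hd1 _ htb]
    have h1 : |inner ℝ t v / ‖t‖| ≤ ‖v‖ := by
      rw [abs_div, abs_norm, div_le_iff₀ hpos, mul_comm]
      exact abs_real_inner_le_norm t v
    have h2 : |h 0 - h t| ≤ L * b := by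
      have := hL.dist_le_mul 0 t
      rw [Real.dist_eq, dist_zero_left] at this
      exact this.trans (by gcongr; exact not_lt.1 htb)
    rw [← mul_sub, Real.norm_eq_abs, abs_mul, abs_mul, abs_mul,
      abs_of_nonneg (hmono.deriv_nonneg (x := ‖t‖))]
    calc deriv ψ ‖t‖ * (|inner ℝ t v / ‖t‖| * |g t|) * |h 0 - h t|
        ≤ deriv ψ ‖t‖ * (‖v‖ * (M * (‖t‖ ^ (Module.finrank ℝ E - 1))⁻¹)) * (L * b) := by
          have := hmono.deriv_nonneg (x := ‖t‖)
          have := hM t ht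
          gcongr
      _ = _ := by ring
  · rw [integral_radial_mul_homogeneous μ (deriv ψ) fun _ => M * ‖v‖ * L * b, hint, one_mul,
      integral_const, smul_eq_mul]
    ring

end IntegrationByParts

section PrincipalValue

open Filter Topology

theorem tendsto_smoothTransition_scaled {ε r : ℝ} :
    Tendsto (fun δ : ℝ => Real.smoothTransition ((r - ε) / δ)) (𝓝[>] 0)
      (𝓝 (if ε < r then 1 else 0)) := by
  refine tendsto_const_nhds.congr' ?_
  split_ifs with h
  · filter_upwards [Ioo_mem_nhdsGT (sub_pos.2 h)] with δ hδ
    exact (Real.smoothTransition.one_of_one_le ((one_le_div hδ.1).2 hδ.2.le)).symm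
  · filter_upwards [self_mem_nhdsWithin] with δ hδ
    exact (Real.smoothTransition.zero_of_nonpos
      (div_nonpos_of_nonpos_of_nonneg (by linarith) (le_of_lt hδ))).symm

variable {E : Type*} [NormedAddCommGroup E]

variable [MeasurableSpace E] [BorelSpace E]

theorem measurableSet_lt_norm (ε : ℝ) :
    MeasurableSet {t : E | ε < ‖t‖} :=
  (isOpen_lt continuous_const continuous_norm).measurableSet

theorem integrableOn_lt_norm_of_hasCompactSupport (μ : Measure E) [IsFiniteMeasureOnCompacts μ]
    {w : E → ℝ} (hw : ContinuousOn w {0}ᶜ) (hwc : HasCompactSupport w) {ε : ℝ} (hε : 0 < ε) :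
    IntegrableOn w {t | ε < ‖t‖} μ := by
  have hK : IsCompact (tsupport w ∩ {t | ε ≤ ‖t‖}) :=
    hwc.isCompact.inter_right (isClosed_le continuous_const continuous_norm)
  have h1 : IntegrableOn w (tsupport w ∩ {t | ε ≤ ‖t‖}) μ :=
    (hw.mono fun t ht h => by
      have := ht.2
      simp_all [not_le.2 hε]).integrableOn_compact hK
  exact h1.of_forall_sdiff_eq_zero (measurableSet_lt_norm ε) fun t ht =>
    image_eq_zero_of_notMem_tsupport fun h => ht.2 ⟨h, le_of_lt (mem_ofPred.1 ht.1)⟩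

theorem tendsto_integral_smoothTransition (μ : Measure E) {w : E → ℝ} {ε : ℝ}
    (hw : AEStronglyMeasurable w μ) (hwi : IntegrableOn w {t | ε < ‖t‖} μ) :
    Tendsto (fun δ : ℝ => ∫ t, Real.smoothTransition ((‖t‖ - ε) / δ) * w t ∂μ) (𝓝[>] 0)
      (𝓝 (∫ t in {t | ε < ‖t‖}, w t ∂μ)) := by
  rw [← integral_indicator (measurableSet_lt_norm ε)]
  refine tendsto_integral_filter_of_dominated_convergence
    (fun t => |{t : E | ε < ‖t‖}.indicator w t|) ?_ ?_
    (hwi.integrable_indicator (measurableSet_lt_norm ε)).abs ?_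
  · refine .of_forall fun δ => AEStronglyMeasurable.mul ?_ hw
    exact (Real.smoothTransition.continuous.comp
      (by fun_prop : Continuous fun t : E => (‖t‖ - ε) / δ)).aestronglyMeasurable
  · filter_upwards [self_mem_nhdsWithin] with δ hδ
    refine .of_forall fun t => ?_
    rw [norm_mul, Real.norm_eq_abs, Real.norm_eq_abs,
      abs_of_nonneg (Real.smoothTransition.nonneg _)]
    by_cases h : ε < ‖t‖
    · rw [indicator_of_mem (by exact h)]
      exact mul_le_of_le_one_left (abs_nonneg _) (Real.smoothTransition.le_one _)
    · rw [Real.smoothTransition.zero_of_nonpos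
        (div_nonpos_of_nonpos_of_nonneg (by linarith) (le_of_lt hδ)), zero_mul]
      exact abs_nonneg _
  · refine .of_forall fun t => ?_
    convert (tendsto_smoothTransition_scaled (ε := ε) (r := ‖t‖)).mul_const (w t) using 2
    by_cases h : ε < ‖t‖ <;> simp [indicator, h]

variable [InnerProductSpace ℝ E] [FiniteDimensional ℝ E]

theorem tendsto_setIntegral_lt_norm [Nontrivial E] (μ : Measure E) [μ.IsAddHaarMeasure]
    {w : E → ℝ} (hw : Integrable w μ) :
    Tendsto (fun ε : ℝ => ∫ t in {t | ε < ‖t‖}, w t ∂μ) (𝓝[>] 0) (𝓝 (∫ t, w t ∂μ)) := by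
  simp_rw [← integral_indicator (measurableSet_lt_norm _)]
  refine tendsto_integral_filter_of_dominated_convergence (fun t => ‖w t‖)
    (.of_forall fun ε => (hw.indicator (measurableSet_lt_norm ε)).aestronglyMeasurable)
    (.of_forall fun ε => .of_forall fun t => norm_indicator_le_norm_self _ _) hw.norm ?_
  filter_upwards [compl_mem_ae_iff.2 (measure_singleton (μ := μ) (0 : E))] with t ht
  refine tendsto_const_nhds.congr' ?_
  filter_upwards [Ioo_mem_nhdsGT (norm_pos_iff.2 ht)] with ε hε
  rw [indicator_of_mem (by exact hε.2)]

/-- The distributional derivative of a function homogeneous of degree `1 - dim E` is the principal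
value of its pointwise derivative plus a multiple of the Dirac mass at the origin. -/
theorem tendsto_integral_fderiv_mul_of_homogeneous [Nontrivial E] (μ : Measure E)
    [μ.IsAddHaarMeasure] {g h : E → ℝ} (hg : ContDiffOn ℝ 1 g {0}ᶜ)
    (hom : ∀ c : ℝ, 0 < c → ∀ t : E, t ≠ 0 →
      g (c • t) = (c ^ (Module.finrank ℝ E - 1))⁻¹ * g t)
    (hh : ContDiff ℝ 1 h) (hhc : HasCompactSupport h) (v : E) :
    Tendsto (fun ε : ℝ => ∫ t in {t | ε < ‖t‖}, fderiv ℝ g t v * h t ∂μ) (𝓝[>] 0)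
      (𝓝 (-∫ t, g t * fderiv ℝ h t v ∂μ -
        (∫ s : sphere (0 : E) 1, g s * inner ℝ (s : E) v ∂μ.toSphere) * h 0)) := by
  set c := ∫ s : sphere (0 : E) 1, g s * inner ℝ (s : E) v ∂μ.toSphere
  obtain ⟨C, hC⟩ := abs_integral_radial_cutoff_add_le μ hg hom hh hhc v
  have hh' : Continuous fun t => fderiv ℝ h t v :=
    (hh.continuous_fderiv one_ne_zero).clm_apply continuous_const
  have hhc' : HasCompactSupport fun t => fderiv ℝ h t v := hhc.fderiv_apply ℝ v
  have k1 : ContinuousOn (fun t => g t * fderiv ℝ h t v) {0}ᶜ :=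
    hg.continuousOn.mul hh'.continuousOn
  have k2 : ContinuousOn (fun t => fderiv ℝ g t v * h t) {0}ᶜ :=
    (continuousOn_fderiv_apply_compl_zero hg v).mul hh.continuous.continuousOn
  have s1 : HasCompactSupport fun t => g t * fderiv ℝ h t v := hhc'.mul_left
  have s2 : HasCompactSupport fun t => fderiv ℝ g t v * h t := hhc.mul_left
  have est : ∀ ε : ℝ, 0 < ε → |∫ t in {t | ε < ‖t‖},
      (g t * fderiv ℝ h t v + fderiv ℝ g t v * h t) ∂μ + c * h 0| ≤ C * ε := by
    intro ε hε
    have hlim := ((tendsto_integral_smoothTransition μ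
      (aestronglyMeasurable_of_continuousOn_compl_zero μ (k1.add k2))
      (integrableOn_lt_norm_of_hasCompactSupport μ (k1.add k2) (s1.add s2) hε)).add_const
        (c * h 0)).abs
    have hlim' : Tendsto (fun δ : ℝ => C * (ε + δ)) (𝓝[>] 0) (𝓝 (C * ε)) := by
      have : Continuous fun δ : ℝ => C * (ε + δ) := by fun_prop
      simpa using (this.tendsto 0).mono_left nhdsWithin_le_nhds
    refine le_of_tendsto_of_tendsto hlim hlim' ?_
    filter_upwards [self_mem_nhdsWithin] with δ (hδ : 0 < δ)
    refine hC (fun r => Real.smoothTransition ((r - ε) / δ)) ε (ε + δ) ?_ ?_ hε (by linarith)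
      ?_ ?_
    · exact Real.smoothTransition.contDiff.comp (by fun_prop)
    · intro r s hrs
      apply Real.smoothTransition.monotone
      gcongr
    · exact fun r hr => Real.smoothTransition.zero_of_nonpos
        (div_nonpos_of_nonpos_of_nonneg (by linarith) hδ.le)
    · exact fun r hr => Real.smoothTransition.one_of_one_le ((one_le_div hδ).2 (by linarith))
  have hsum : Tendsto (fun ε : ℝ => ∫ t in {t | ε < ‖t‖},
      (g t * fderiv ℝ h t v + fderiv ℝ g t v * h t) ∂μ + c * h 0) (𝓝[>] 0) (𝓝 0) := by
    refine squeeze_zero_norm' (a := fun ε => C * ε) ?_ ?_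
    · filter_upwards [self_mem_nhdsWithin] with ε hε using est ε hε
    · simpa using ((continuous_const_mul C).tendsto 0).mono_left nhdsWithin_le_nhds
  have hint : Integrable (fun t => g t * fderiv ℝ h t v) μ :=
    (locallyIntegrable_of_homogeneous μ hg.continuousOn
      hom).integrable_smul_right_of_hasCompactSupport hh' hhc'
  have := (hsum.sub (tendsto_setIntegral_lt_norm μ hint)).sub_const (c * h 0)
  rw [zero_sub] at this
  refine this.congr' ?_
  filter_upwards [self_mem_nhdsWithin] with ε (hε : 0 < ε)
  rw [integral_add (integrableOn_lt_norm_of_hasCompactSupport μ k1 s1 hε)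
    (integrableOn_lt_norm_of_hasCompactSupport μ k2 s2 hε)]
  ring

/-- A convolution with a locally integrable kernel is differentiated on the smooth factor. -/
theorem differentiableAt_and_fderiv_integral_comp_sub_mul (μ : Measure E) [μ.IsAddHaarMeasure]
    {g f : E → ℝ}
    (hg : LocallyIntegrable g μ) (hf : ContDiff ℝ 1 f) (hfc : HasCompactSupport f) (x v : E) :
    DifferentiableAt ℝ (fun z => ∫ y, g (z - y) * f y ∂μ) x ∧
      fderiv ℝ (fun z => ∫ y, g (z - y) * f y ∂μ) x v =
        ∫ t, g t * fderiv ℝ f (x - t) v ∂μ := by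
  have e : (fun z => ∫ y, g (z - y) * f y ∂μ) =
      convolution g f (ContinuousLinearMap.mul ℝ ℝ) μ := by
    ext z
    rw [convolution_def, ← integral_sub_left_eq_self _ μ z]
    simp
  have hd := hfc.hasFDerivAt_convolution_right (ContinuousLinearMap.mul ℝ ℝ) hg hf x
  rw [e]
  refine ⟨hd.differentiableAt, ?_⟩
  have hi := (hfc.fderiv ℝ).convolutionExists_right
    ((ContinuousLinearMap.mul ℝ ℝ).precompR E) hg (hf.continuous_fderiv one_ne_zero) x
  rw [hd.fderiv, convolution_def, ContinuousLinearMap.integral_apply hi.integrable]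
  rfl

end PrincipalValue

theorem stmt8 (n : ℕ) (k : Euc n → Euc n)
    (hk : ContDiffOn ℝ 2 k {(0 : Euc n)}ᶜ) (hkh : Homog1nV k) (i j : Fin n)
    (f : Euc n → ℝ) (hf : ContDiff ℝ (⊤ : ℕ∞) f) (hfc : HasCompactSupport f) (x : Euc n) :
    DifferentiableAt ℝ (fun z => ∫ y, k (z - y) j * f y) x ∧
    Filter.Tendsto
      (fun ε : ℝ => ∫ y in {y : Euc n | ε < ‖x - y‖}, pd i (fun z => k z j) (x - y) * f y)
      (nhdsWithin 0 (Set.Ioi 0))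
      (nhds (pd i (fun z => ∫ y, k (z - y) j * f y) x -
        (∫ s : Metric.sphere (0 : Euc n) 1,
            k (s : Euc n) j * (s : Euc n) i ∂((volume : Measure (Euc n)).toSphere)) * f x)) := by
  have : Nonempty (Fin n) := ⟨i⟩
  have hn : 1 ≤ n := Fin.pos i
  have hg : ContDiffOn ℝ 1 (fun z => k z j) {(0 : Euc n)}ᶜ :=
    (contDiffOn_euclidean.1 hk j).of_le one_le_two
  have hom : ∀ c : ℝ, 0 < c → ∀ t : Euc n, t ≠ 0 →
      k (c • t) j = (c ^ (Module.finrank ℝ (Euc n) - 1))⁻¹ * k t j := by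
    intro c hc t ht
    rw [hkh c hc t ht, finrank_euclideanSpace_fin, ← Real.rpow_natCast, ← Real.rpow_neg hc.le,
      Nat.cast_sub hn, Nat.cast_one, neg_sub]
    simp
  have hf1 : ContDiff ℝ 1 f := hf.of_le (by exact_mod_cast le_top)
  set v : Euc n := EuclideanSpace.single i 1
  obtain ⟨hdiff, hder⟩ := differentiableAt_and_fderiv_integral_comp_sub_mul volume
    (locallyIntegrable_of_homogeneous volume hg.continuousOn hom) hf1 hfc x v
  refine ⟨hdiff, ?_⟩
  have hh : ContDiff ℝ 1 fun t => f (x - t) := hf1.comp (by fun_prop)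
  have hhc : HasCompactSupport fun t => f (x - t) :=
    hfc.comp_homeomorph (Homeomorph.subLeft x)
  have hder' : ∀ t, fderiv ℝ (fun t => f (x - t)) t v = -fderiv ℝ f (x - t) v := by
    intro t
    have h1 := ((hf1.differentiable one_ne_zero (x - t)).hasFDerivAt.comp t
      ((hasFDerivAt_id t).const_sub x)).fderiv
    exact (congrArg (fun L : Euc n →L[ℝ] ℝ => L v) h1).trans (by simp)
  have key := tendsto_integral_fderiv_mul_of_homogeneous volume hg hom hh hhc v
  simp only [hder', mul_neg, integral_neg, neg_neg, sub_zero] at key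
  rw [← hder] at key
  convert key using 2 with ε
  · rw [← integral_indicator (measurableSet_lt_norm ε), ← integral_sub_left_eq_self _ volume x,
      ← integral_indicator (measurableSet_lt (by fun_prop) (by fun_prop))]
    congr with y
    simp [indicator, pd, v]
  · simp [pd, v, EuclideanSpace.inner_single_right]

end
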